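/- arXiv:1903.05023 — 13 statements merged into one kernel-verified Lean document; each statement's English description precedes it below -/
import Mathlib

section
/- There exist infinitely many positive integers k with gcd(k, 2·3·5·7) = 1 such that for every base-ten digit d ∈ {0,1,2,3,4,5,6,7,8,9} and every positive integer n, the number k·10^n + d·(10^n − 1)/9 (obtained by appending n copies of the digit d to the decimal representation of k) is composite. -/
/-- The number obtained by appending `n` copies of the digit `d` to `k`. -/
def appendDigits (k d n : ℕ) : ℕ := k * 10 ^ n + d * (10 ^ n - 1) / 9

/-- Ten times the repunit with `24` digits; `n ↦ appendDigits k d n` has period `24` modulo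
this number, for positive `n`. -/
def coverModulus : ℕ := 1111111111111111111111110

/-- A residue modulo `coverModulus`, found by solving a covering system, for which every
`appendDigits` value shares a factor with `coverModulus`. -/
def coverResidue : ℕ := 78979567395113612770741

lemma appendDigits_zero (k d : ℕ) : appendDigits k d 0 = k := by
  simp [appendDigits]

lemma appendDigits_succ (k d n : ℕ) : appendDigits k d (n + 1) = 10 * appendDigits k d n + d := by
  obtain ⟨c, hc⟩ : ∃ c, 10 ^ n = 9 * c + 1 := by
    induction n with
    | zero => exact ⟨0, rfl⟩
    | succ n ih =>
      obtain ⟨c, hc⟩ := ih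
      exact ⟨10 * c + 1, by rw [pow_succ, hc]; ring⟩
  have h₁ : d * (10 ^ n - 1) / 9 = d * c :=
    Nat.div_eq_of_eq_mul_right (by norm_num) (by rw [hc, Nat.add_sub_cancel]; ring)
  have h₂ : d * (10 ^ (n + 1) - 1) / 9 = d * (10 * c + 1) :=
    Nat.div_eq_of_eq_mul_right (by norm_num) (by
      rw [show 10 ^ (n + 1) = 9 * (10 * c + 1) + 1 by rw [pow_succ, hc]; ring,
        Nat.add_sub_cancel]; ring)
  rw [appendDigits, appendDigits, h₁, h₂]
  ring

lemma le_appendDigits (k d n : ℕ) : k ≤ appendDigits k d n :=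
  (Nat.le_mul_of_pos_right k (by positivity)).trans (Nat.le_add_right _ _)

lemma appendDigits_modEq {N k l : ℕ} (h : k ≡ l [MOD N]) (d n : ℕ) :
    appendDigits k d n ≡ appendDigits l d n [MOD N] :=
  (h.mul_right _).add_right _

lemma appendDigits_add_period (k d n : ℕ) :
    appendDigits k d (n + 1 + 24) ≡ appendDigits k d (n + 1) [MOD coverModulus] := by
  induction n with
  | zero =>
    refine ((Nat.modEq_iff_dvd' ?_).2 ?_).symm
    · simp only [appendDigits_succ, appendDigits_zero]
      lia
    · refine ⟨9 * k + d, ?_⟩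
      simp only [appendDigits_succ, appendDigits_zero, coverModulus]
      lia
  | succ n ih =>
    rw [show n + 1 + 1 + 24 = n + 1 + 24 + 1 by ring, appendDigits_succ,
      appendDigits_succ k d (n + 1)]
    exact (ih.mul_left 10).add_right d

lemma appendDigits_modEq_mod (k d n : ℕ) :
    appendDigits k d (n + 1) ≡ appendDigits k d (n % 24 + 1) [MOD coverModulus] := by
  induction n using Nat.strong_induction_on with
  | _ n ih =>
    obtain h | h := lt_or_ge n 24
    · rw [Nat.mod_eq_of_lt h]
    · obtain ⟨m, rfl⟩ := Nat.exists_eq_add_of_le' h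
      rw [Nat.add_mod_right, show m + 24 + 1 = m + 1 + 24 by ring]
      exact (appendDigits_add_period k d m).trans (ih m (by lia))

lemma gcd_appendDigits_coverResidue_ne_one :
    ∀ d < 10, ∀ n < 24,
      Nat.gcd (appendDigits coverResidue d (n + 1)) coverModulus ≠ 1 := by
  decide +kernel

lemma gcd_appendDigits_ne_one {k d n : ℕ} (hk : k ≡ coverResidue [MOD coverModulus])
    (hd : d ≤ 9) (hn : 0 < n) : Nat.gcd (appendDigits k d n) coverModulus ≠ 1 := by
  obtain ⟨m, rfl⟩ := Nat.exists_eq_add_of_le' hn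
  rw [((appendDigits_modEq hk d (m + 1)).trans (appendDigits_modEq_mod _ d m)).gcd_eq]
  exact gcd_appendDigits_coverResidue_ne_one d (by lia) _ (Nat.mod_lt _ (by norm_num))

/-- There exist infinitely many positive integers `k` with `gcd(k, 2*3*5*7) = 1` such that
for every base-ten digit `d` and every positive integer `n`, the number
`k * 10^n + d * (10^n - 1) / 9` (appending `n` copies of digit `d` to `k`) is composite. -/
theorem stmt_0 :
    {k : ℕ | 0 < k ∧ Nat.gcd k (2 * 3 * 5 * 7) = 1 ∧
      ∀ d : ℕ, d ≤ 9 → ∀ n : ℕ, 0 < n →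
        1 < k * 10 ^ n + d * (10 ^ n - 1) / 9 ∧
        ¬ Nat.Prime (k * 10 ^ n + d * (10 ^ n - 1) / 9)}.Infinite := by
  have hpos : 1 < coverModulus := by norm_num [coverModulus]
  refine Set.infinite_of_forall_exists_gt fun a => ?_
  have hlarge : a + coverModulus < coverResidue + coverModulus * (a + 1) := by
    norm_num [coverModulus, coverResidue]
    lia
  have hmod : coverResidue + coverModulus * (a + 1) ≡ coverResidue [MOD coverModulus] := by
    simp [Nat.ModEq]
  generalize coverResidue + coverModulus * (a + 1) = k at hlarge hmod
  refine ⟨k, ⟨by lia, ?_, fun d hd n hn => ?_⟩, by lia⟩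
  · have h : k ≡ coverResidue [MOD 2 * 3 * 5 * 7] := hmod.of_dvd (by norm_num [coverModulus])
    rw [h.gcd_eq]
    norm_num [coverResidue]
  · have hle := le_appendDigits k d n
    have hgcd := gcd_appendDigits_ne_one hmod hd hn
    change 1 < appendDigits k d n ∧ ¬ (appendDigits k d n).Prime
    refine ⟨by lia, fun hp => ?_⟩
    rcases hp.eq_one_or_self_of_dvd _ (Nat.gcd_dvd_left _ coverModulus) with h | h
    · exact hgcd h
    · have := Nat.gcd_le_right (appendDigits k d n) (by lia : 0 < coverModulus)
      lia
end

section
/- The integer k = 4942768284976776320 is a pandigital seed: gcd(k, 21) = 1, and for every digit d ∈ {1, 3, 7, 9} and every positive integer n, the number k·10^n + d·(10^n − 1)/9 is composite. -/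
/-- If `10 ^ m ≡ 1 [MOD 9 * p]`, whether `p` divides `k` followed by `n` digits `d` depends only
on `n` modulo `m`. -/
theorem dvd_append_digits {k d p m r n : ℕ} (hm : 10 ^ m ≡ 1 [MOD 9 * p])
    (hr : (9 * k + d) * 10 ^ r ≡ d [MOD 9 * p]) (hn : n % m = r) :
    p ∣ k * 10 ^ n + d * (10 ^ n - 1) / 9 := by
  have hpow : 10 ^ n ≡ 10 ^ r [MOD 9 * p] := by
    rw [← Nat.div_add_mod n m, hn, pow_add, pow_mul]
    simpa using (hm.pow (n / m)).mul_right (10 ^ r)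
  have hmod : (9 * k + d) * 10 ^ n ≡ d [MOD 9 * p] := (hpow.mul_left _).trans hr
  have hdvd : 9 ∣ d * (10 ^ n - 1) :=
    Dvd.dvd.mul_left (by simpa using Nat.sub_dvd_pow_sub_pow 10 1 n) d
  have hpos : 1 ≤ 10 ^ n := Nat.one_le_pow _ _ (by norm_num)
  have heq : (9 * k + d) * 10 ^ n = d + 9 * (k * 10 ^ n + d * (10 ^ n - 1) / 9) := by
    rw [mul_add, Nat.mul_div_cancel' hdvd]
    obtain ⟨t, ht⟩ := Nat.exists_eq_add_of_le hpos
    rw [ht, Nat.add_sub_cancel_left]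
    ring
  have h9 : 9 * p ∣ 9 * (k * 10 ^ n + d * (10 ^ n - 1) / 9) := by
    have := (Nat.modEq_iff_dvd' (by omega)).mp hmod.symm
    rwa [heq, Nat.add_sub_cancel_left] at this
  exact Nat.dvd_of_mul_dvd_mul_left (by norm_num) h9

theorem not_prime_append_digits {k d p m r n : ℕ} (hp : 1 < p) (hpk : p < k)
    (hm : 10 ^ m ≡ 1 [MOD 9 * p]) (hr : (9 * k + d) * 10 ^ r ≡ d [MOD 9 * p])
    (hn : n % m = r) : ¬ Nat.Prime (k * 10 ^ n + d * (10 ^ n - 1) / 9) := by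
  have hle : k ≤ k * 10 ^ n := Nat.le_mul_of_pos_right k (by positivity)
  exact Nat.not_prime_of_dvd_of_lt (dvd_append_digits hm hr hn) hp (by omega)


/-- `k = 4942768284976776320` is a pandigital seed: `gcd(k, 21) = 1` and for every digit
`d ∈ {1, 3, 7, 9}` and every positive integer `n`, the number
`k * 10^n + d * (10^n - 1) / 9` is composite. -/
theorem stmt_1 :
    Nat.gcd 4942768284976776320 21 = 1 ∧
    ∀ d ∈ ({1, 3, 7, 9} : Finset ℕ), ∀ n : ℕ, 0 < n →
      1 < 4942768284976776320 * 10 ^ n + d * (10 ^ n - 1) / 9 ∧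
      ¬ Nat.Prime (4942768284976776320 * 10 ^ n + d * (10 ^ n - 1) / 9) := by
  refine ⟨by norm_num, fun d hd n _ => ⟨?_, ?_⟩⟩
  · have : 1 ≤ 10 ^ n := Nat.one_le_pow _ _ (by norm_num)
    omega
  simp only [Finset.mem_insert, Finset.mem_singleton] at hd
  rcases hd with rfl | rfl | rfl | rfl
  · have h : n % 2 = 0 ∨ n % 3 = 0 ∨ n % 3 = 1 ∨ n % 6 = 5 := by
      omega
    rcases h with h | h | h | h
    · exact not_prime_append_digits (p := 11) (by norm_num) (by norm_num) (by decide) (by decide) h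
    · exact not_prime_append_digits (p := 37) (by norm_num) (by norm_num) (by decide) (by decide) h
    · exact not_prime_append_digits (p := 3) (by norm_num) (by norm_num) (by decide) (by decide) h
    · exact not_prime_append_digits (p := 13) (by norm_num) (by norm_num) (by decide) (by decide) h
  · have h : n % 2 = 0 ∨ n % 3 = 0 ∨ n % 6 = 1 ∨ n % 6 = 5 := by
      omega
    rcases h with h | h | h | h
    · exact not_prime_append_digits (p := 11) (by norm_num) (by norm_num) (by decide) (by decide) h
    · exact not_prime_append_digits (p := 37) (by norm_num) (by norm_num) (by decide) (by decide) h
    · exact not_prime_append_digits (p := 13) (by norm_num) (by norm_num) (by decide) (by decide) h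
    · exact not_prime_append_digits (p := 7) (by norm_num) (by norm_num) (by decide) (by decide) h
  · have h : n % 2 = 0 ∨ n % 3 = 0 ∨ n % 3 = 1 ∨ n % 5 = 0 ∨ n % 5 = 1 ∨
      n % 15 = 2 ∨ n % 30 = 23 ∨ n % 30 = 29 := by
      have hlt : n % 30 < 30 := Nat.mod_lt n (by norm_num)
      rw [← Nat.mod_mod_of_dvd n (show 2 ∣ 30 by norm_num),
        ← Nat.mod_mod_of_dvd n (show 3 ∣ 30 by norm_num),
        ← Nat.mod_mod_of_dvd n (show 5 ∣ 30 by norm_num),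
        ← Nat.mod_mod_of_dvd n (show 15 ∣ 30 by norm_num)]
      generalize n % 30 = s at hlt ⊢
      revert s
      decide
    rcases h with h | h | h | h | h | h | h | h
    · exact not_prime_append_digits (p := 11) (by norm_num) (by norm_num) (by decide) (by decide) h
    · exact not_prime_append_digits (p := 37) (by norm_num) (by norm_num) (by decide) (by decide) h
    · exact not_prime_append_digits (p := 3) (by norm_num) (by norm_num) (by decide) (by decide) h
    · exact not_prime_append_digits (p := 271) (by norm_num) (by norm_num) (by decide) (by decide) h
    · exact not_prime_append_digits (p := 41) (by norm_num) (by norm_num) (by decide) (by decide) h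
    · exact not_prime_append_digits (p := 31) (by norm_num) (by norm_num) (by decide) (by decide) h
    · exact not_prime_append_digits (p := 211) (by norm_num) (by norm_num) (by decide) (by decide) h
    · exact not_prime_append_digits (p := 241) (by norm_num) (by norm_num) (by decide) (by decide) h
  · have h : n % 2 = 0 ∨ n % 3 = 0 ∨ n % 4 = 3 ∨ n % 8 = 1 ∨ n % 8 = 5 := by
      omega
    rcases h with h | h | h | h | h
    · exact not_prime_append_digits (p := 11) (by norm_num) (by norm_num) (by decide) (by decide) h
    · exact not_prime_append_digits (p := 37) (by norm_num) (by norm_num) (by decide) (by decide) h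
    · exact not_prime_append_digits (p := 101) (by norm_num) (by norm_num) (by decide) (by decide) h
    · exact not_prime_append_digits (p := 73) (by norm_num) (by norm_num) (by decide) (by decide) h
    · exact not_prime_append_digits (p := 137) (by norm_num) (by norm_num) (by decide) (by decide) h
end

section
/- Every positive integer k satisfying k ≡ 1970728582053685108721 (mod 19657858137687083324010) has gcd(k, 2·3·5·7) = 1, and for every base-ten digit d ∈ {0,…,9} and every positive integer n, the number k·10^n + d·(10^n − 1)/9 is composite. -/
theorem nine_mul_repdigit_add (d n : ℕ) : 9 * (d * (10 ^ n - 1) / 9) + d = d * 10 ^ n := by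
  have h : 9 ∣ d * (10 ^ n - 1) :=
    Dvd.dvd.mul_left (by simpa using Nat.sub_dvd_pow_sub_pow 10 1 n) d
  rw [Nat.mul_div_cancel' h, Nat.mul_sub, mul_one,
    Nat.sub_add_cancel (Nat.le_mul_of_pos_right d (by positivity))]

/-- If `10` has period `o` modulo `9 * p`, then divisibility by `p` of `k` followed by `n` copies
of `d` depends only on `k` modulo `p` and `n` modulo `o`. -/
theorem dvd_append_of_mod_eq {k M p d n : ℕ} (k₀ o a : ℕ) (hk : k % M = k₀) (hn : n % o = a)
    (hM : p ∣ M) (ho : 10 ^ o ≡ 1 [MOD 9 * p]) (ha : (9 * k₀ + d) * 10 ^ a ≡ d [MOD 9 * p]) :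
    p ∣ k * 10 ^ n + d * (10 ^ n - 1) / 9 := by
  have hkp : 9 * k ≡ 9 * k₀ [MOD 9 * p] :=
    (((Nat.mod_modEq k M).of_dvd hM).symm.trans (by rw [hk])).mul_left' 9
  have hpow : 10 ^ n ≡ 10 ^ a [MOD 9 * p] := by
    rw [← Nat.mod_add_div n o, hn, pow_add, pow_mul]
    simpa using (ho.pow (n / o)).mul_left (10 ^ a)
  have hsum : 9 * (k * 10 ^ n + d * (10 ^ n - 1) / 9) + d = (9 * k + d) * 10 ^ n := by
    have := nine_mul_repdigit_add d n
    linear_combination this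
  have hmod : 9 * (k * 10 ^ n + d * (10 ^ n - 1) / 9) + d ≡ 0 + d [MOD 9 * p] := by
    rw [hsum, zero_add]
    exact ((hkp.add_right d).mul hpow).trans ha
  exact Nat.dvd_of_mul_dvd_mul_left (by norm_num)
    ((Nat.modEq_zero_iff_dvd).1 (Nat.ModEq.add_right_cancel' d hmod))

theorem dvd_append_of_dvd_digit {k p d n : ℕ} (hn : 0 < n) (hp : p ∣ 10) (hd : p ∣ d) :
    p ∣ k * 10 ^ n + d * (10 ^ n - 1) / 9 := by
  refine dvd_add ((hp.trans (dvd_pow_self 10 hn.ne')).mul_left k) ?_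
  rw [Nat.mul_div_assoc d (by simpa using Nat.sub_dvd_pow_sub_pow 10 1 n)]
  exact hd.mul_right _

theorem exists_small_dvd_append {k d n : ℕ} (hd : d ≤ 9) (hn : 0 < n)
    (hmod : k % 19657858137687083324010 = 1970728582053685108721) :
    ∃ p, 1 < p ∧ p < 272 ∧ p ∣ k * 10 ^ n + d * (10 ^ n - 1) / 9 := by
  have cover (p o a : ℕ) (hna : n % o = a) (hp : 1 < p ∧ p < 272)
      (hM : p ∣ 19657858137687083324010) (ho : 10 ^ o ≡ 1 [MOD 9 * p])
      (ha : (9 * 1970728582053685108721 + d) * 10 ^ a ≡ d [MOD 9 * p]) :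
      ∃ p, 1 < p ∧ p < 272 ∧ p ∣ k * 10 ^ n + d * (10 ^ n - 1) / 9 :=
    ⟨p, hp.1, hp.2, dvd_append_of_mod_eq _ o a hmod hna hM ho ha⟩
  have even (h : 2 ∣ d) : ∃ p, 1 < p ∧ p < 272 ∧ p ∣ k * 10 ^ n + d * (10 ^ n - 1) / 9 :=
    ⟨2, by norm_num, by norm_num, dvd_append_of_dvd_digit hn (by norm_num) h⟩
  interval_cases d
  · exact even (by norm_num)
  · have h : n % 2 = 0 ∨ n % 3 = 0 ∨ n % 3 = 1 ∨ n % 6 = 5 := by omega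
    rcases h with h | h | h | h
    · exact cover 11 2 0 h (by decide) (by decide) (by decide) (by decide)
    · exact cover 37 3 0 h (by decide) (by decide) (by decide) (by decide)
    · exact cover 3 3 1 h (by decide) (by decide) (by decide) (by decide)
    · exact cover 13 6 5 h (by decide) (by decide) (by decide) (by decide)
  · exact even (by norm_num)
  · have h : n % 2 = 0 ∨ n % 3 = 0 ∨ n % 6 = 1 ∨ n % 6 = 5 := by omega
    rcases h with h | h | h | h
    · exact cover 11 2 0 h (by decide) (by decide) (by decide) (by decide)
    · exact cover 37 3 0 h (by decide) (by decide) (by decide) (by decide)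
    · exact cover 13 6 1 h (by decide) (by decide) (by decide) (by decide)
    · exact cover 7 6 5 h (by decide) (by decide) (by decide) (by decide)
  · exact even (by norm_num)
  · exact ⟨5, by norm_num, by norm_num, dvd_append_of_dvd_digit hn (by norm_num) dvd_rfl⟩
  · exact even (by norm_num)
  · have h : n % 2 = 0 ∨ n % 3 = 0 ∨ n % 3 = 1 ∨ n % 5 = 0 ∨ n % 5 = 1 ∨ n % 15 = 2 ∨
        n % 30 = 23 ∨ n % 30 = 29 := by
      have hlt : n % 30 < 30 := Nat.mod_lt n (by norm_num)
      generalize hr : n % 30 = r at hlt ⊢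
      interval_cases r <;> omega
    rcases h with h | h | h | h | h | h | h | h
    · exact cover 11 2 0 h (by decide) (by decide) (by decide) (by decide)
    · exact cover 37 3 0 h (by decide) (by decide) (by decide) (by decide)
    · exact cover 3 3 1 h (by decide) (by decide) (by decide) (by decide)
    · exact cover 271 5 0 h (by decide) (by decide) (by decide) (by decide)
    · exact cover 41 5 1 h (by decide) (by decide) (by decide) (by decide)
    · exact cover 31 15 2 h (by decide) (by decide) (by decide) (by decide)
    · exact cover 211 30 23 h (by decide) (by decide) (by decide) (by decide)
    · exact cover 241 30 29 h (by decide) (by decide) (by decide) (by decide)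
  · exact even (by norm_num)
  · have h : n % 2 = 0 ∨ n % 4 = 3 ∨ n % 8 = 1 ∨ n % 8 = 5 := by omega
    rcases h with h | h | h | h
    · exact cover 11 2 0 h (by decide) (by decide) (by decide) (by decide)
    · exact cover 101 4 3 h (by decide) (by decide) (by decide) (by decide)
    · exact cover 73 8 1 h (by decide) (by decide) (by decide) (by decide)
    · exact cover 137 8 5 h (by decide) (by decide) (by decide) (by decide)

/-- Every positive integer `k ≡ 1970728582053685108721 (mod 19657858137687083324010)`
has `gcd(k, 2*3*5*7) = 1`, and for every base-ten digit `d` and positive integer `n`,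
the number `k * 10^n + d * (10^n - 1) / 9` is composite. -/
theorem stmt_2 (k : ℕ) (hk : 0 < k)
    (hmod : k % 19657858137687083324010 = 1970728582053685108721) :
    Nat.gcd k (2 * 3 * 5 * 7) = 1 ∧
    ∀ d : ℕ, d ≤ 9 → ∀ n : ℕ, 0 < n →
      1 < k * 10 ^ n + d * (10 ^ n - 1) / 9 ∧
      ¬ Nat.Prime (k * 10 ^ n + d * (10 ^ n - 1) / 9) := by
  refine ⟨?_, fun d hd n hn => ?_⟩
  · rw [← (show Nat.gcd (19657858137687083324010 * (k / 19657858137687083324010) +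
      1970728582053685108721) (2 * 3 * 5 * 7) = Nat.gcd k (2 * 3 * 5 * 7) by
        rw [← hmod, Nat.div_add_mod])]
    rw [show 19657858137687083324010 = (2 * 3 * 5 * 7) * 93608848274700396781 by norm_num,
      mul_assoc, Nat.gcd_mul_left_add_left]
    norm_num
  · obtain ⟨p, hp, hp', hdvd⟩ := exists_small_dvd_append hd hn hmod
    have hk' : 1970728582053685108721 ≤ k := hmod ▸ Nat.mod_le k _
    have hle : k ≤ k * 10 ^ n := Nat.le_mul_of_pos_right k (by positivity)
    exact ⟨by omega, Nat.not_prime_of_dvd_of_lt hdvd hp (by omega)⟩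
end

section
/- For every positive integer n, the number 37·10^n + (10^n − 1)/9 (obtained by appending n copies of the digit 1 to 37) is composite. -/
theorem exists_pow_six_mul_eq (q : ℕ) : ∃ k, 10 ^ (6 * q) = 999999 * k + 1 := by
  have h : 10 ^ (6 * q) ≡ 1 [MOD 999999] := by
    rw [pow_mul]
    simpa using (show 10 ^ 6 ≡ 1 [MOD 999999] by decide).pow q
  have hpos : 1 ≤ 10 ^ (6 * q) := Nat.one_le_pow _ _ (by norm_num)
  obtain ⟨k, hk⟩ := (Nat.modEq_iff_dvd' hpos).1 h.symm
  exact ⟨k, by omega⟩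

/-- The covering system behind the theorem: the primes `3`, `7`, `13`, `37` cover all `n`. -/
theorem exists_covering_dvd (n : ℕ) :
    ∃ p ∈ ({3, 7, 13, 37} : Finset ℕ), p ∣ 37 * 10 ^ n + (10 ^ n - 1) / 9 := by
  obtain ⟨k, hk⟩ := exists_pow_six_mul_eq (n / 6)
  have hn : 10 ^ n = (999999 * k + 1) * 10 ^ (n % 6) := by
    rw [← hk, ← pow_add, Nat.div_add_mod]
  have hlt : n % 6 < 6 := Nat.mod_lt _ (by norm_num)
  rw [hn]
  generalize n % 6 = i at hlt
  interval_cases i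
  · exact ⟨37, by simp, by omega⟩
  · exact ⟨7, by simp, by omega⟩
  · exact ⟨3, by simp, by omega⟩
  · exact ⟨37, by simp, by omega⟩
  · exact ⟨13, by simp, by omega⟩
  · exact ⟨3, by simp, by omega⟩

/-- For every positive integer `n`, the number `37 * 10^n + (10^n - 1) / 9`
(appending `n` copies of the digit 1 to 37) is composite. -/
theorem stmt_3 (n : ℕ) (hn : 0 < n) :
    1 < 37 * 10 ^ n + (10 ^ n - 1) / 9 ∧
    ¬ Nat.Prime (37 * 10 ^ n + (10 ^ n - 1) / 9) := by
  have hpow : 10 ≤ 10 ^ n := Nat.le_self_pow hn.ne' 10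
  refine ⟨by omega, fun hprime => ?_⟩
  obtain ⟨p, hp, hdvd⟩ := exists_covering_dvd n
  simp only [Finset.mem_insert, Finset.mem_singleton] at hp
  rcases (Nat.dvd_prime hprime).1 hdvd with h | h <;> omega
end

section
/- For every positive integer n, the number 891·10^n + 7·(10^n − 1)/9 (obtained by appending n copies of the digit 7 to 891) is composite. -/
theorem exists_ten_pow_six_mul_eq (m : ℕ) : ∃ t, 10 ^ (6 * m) = 999999 * t + 1 := by
  have h : 999999 ∣ (10 ^ 6) ^ m - 1 ^ m := Nat.sub_dvd_pow_sub_pow (10 ^ 6) 1 m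
  rw [← pow_mul, one_pow] at h
  obtain ⟨t, ht⟩ := h
  have hpos : 0 < 10 ^ (6 * m) := by positivity
  exact ⟨t, by omega⟩

/-- For every positive integer `n`, the number `891 * 10^n + 7 * (10^n - 1) / 9`
(appending `n` copies of the digit 7 to 891) is composite. -/
theorem stmt_5 (n : ℕ) (hn : 0 < n) :
    1 < 891 * 10 ^ n + 7 * (10 ^ n - 1) / 9 ∧
    ¬ Nat.Prime (891 * 10 ^ n + 7 * (10 ^ n - 1) / 9) := by
  have hpos : 0 < 10 ^ n := by positivity
  refine ⟨by omega, ?_⟩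
  obtain ⟨t, ht⟩ := exists_ten_pow_six_mul_eq (n / 6)
  have hx : 10 ^ n = (999999 * t + 1) * 10 ^ (n % 6) := by
    rw [← ht, ← pow_add, Nat.div_add_mod]
  -- The covering set is {3, 11, 13, 37}, with `n` taken modulo 6.
  have hr : n % 6 < 6 := Nat.mod_lt _ (by norm_num)
  generalize n % 6 = r at hx hr
  generalize 10 ^ n = x at hx hpos ⊢
  interval_cases r
  · exact Nat.not_prime_of_dvd_of_lt (m := 11) (by omega) (by norm_num) (by omega)
  · exact Nat.not_prime_of_dvd_of_lt (m := 37) (by omega) (by norm_num) (by omega)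
  · exact Nat.not_prime_of_dvd_of_lt (m := 11) (by omega) (by norm_num) (by omega)
  · exact Nat.not_prime_of_dvd_of_lt (m := 3) (by omega) (by norm_num) (by omega)
  · exact Nat.not_prime_of_dvd_of_lt (m := 11) (by omega) (by norm_num) (by omega)
  · exact Nat.not_prime_of_dvd_of_lt (m := 13) (by omega) (by norm_num) (by omega)
end

section
/- For every nonnegative integer n, at least one of the primes 3, 11, 13, 37 divides 891·10^n + 7·(10^n − 1)/9; more precisely, writing n = 6m + i with 0 ≤ i ≤ 5, the number is divisible by 11, 37, 11, 3, 11, 13 according as i = 0, 1, 2, 3, 4, 5. -/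
/-- Since `999999 = 10 ^ 6 - 1`, the residue of `10 ^ n` modulo `999999` depends only on
`n % 6`. -/
theorem exists_ten_pow_eq (n : ℕ) : ∃ q : ℕ, 10 ^ n = 10 ^ (n % 6) * (999999 * q + 1) := by
  obtain ⟨q, hq⟩ : 10 ^ 6 - 1 ∣ (10 ^ 6) ^ (n / 6) - 1 := Nat.sub_one_dvd_pow_sub_one _ _
  have hpos : 0 < (10 ^ 6) ^ (n / 6) := by positivity
  refine ⟨q, ?_⟩
  have h : (10 ^ 6) ^ (n / 6) = 999999 * q + 1 := by omega
  rw [← h, ← pow_mul, ← pow_add, Nat.mod_add_div]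

/-- For every nonnegative integer `n`, at least one of the primes 3, 11, 13, 37 divides
`891 * 10^n + 7 * (10^n - 1) / 9`; more precisely, according as `n % 6 = 0,1,2,3,4,5`,
the number is divisible by `11, 37, 11, 3, 11, 13`. -/
theorem stmt_6 (n : ℕ) :
    (3 ∣ 891 * 10 ^ n + 7 * (10 ^ n - 1) / 9 ∨
     11 ∣ 891 * 10 ^ n + 7 * (10 ^ n - 1) / 9 ∨
     13 ∣ 891 * 10 ^ n + 7 * (10 ^ n - 1) / 9 ∨
     37 ∣ 891 * 10 ^ n + 7 * (10 ^ n - 1) / 9) ∧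
    (n % 6 = 0 → 11 ∣ 891 * 10 ^ n + 7 * (10 ^ n - 1) / 9) ∧
    (n % 6 = 1 → 37 ∣ 891 * 10 ^ n + 7 * (10 ^ n - 1) / 9) ∧
    (n % 6 = 2 → 11 ∣ 891 * 10 ^ n + 7 * (10 ^ n - 1) / 9) ∧
    (n % 6 = 3 → 3 ∣ 891 * 10 ^ n + 7 * (10 ^ n - 1) / 9) ∧
    (n % 6 = 4 → 11 ∣ 891 * 10 ^ n + 7 * (10 ^ n - 1) / 9) ∧
    (n % 6 = 5 → 13 ∣ 891 * 10 ^ n + 7 * (10 ^ n - 1) / 9) := by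
  obtain ⟨q, hq⟩ := exists_ten_pow_eq n
  have hlt : n % 6 < 6 := Nat.mod_lt _ (by norm_num)
  generalize n % 6 = i at *
  rw [hq]
  interval_cases i <;> refine ⟨?_, ?_, ?_, ?_, ?_, ?_, ?_⟩ <;> omega
end

section
/- For every positive integer n, the number 10176·10^n − 1 (obtained by appending n copies of the digit 9 to 10175) is composite. -/
/-- The powers of `10` have period `6` modulo `37037 = 7 * 11 * 13 * 37`. -/
theorem ten_pow_mod_37037 (n : ℕ) : 10 ^ n % 37037 = 10 ^ (n % 6) % 37037 := by
  conv_lhs => rw [← Nat.mod_add_div n 6, pow_add, pow_mul, Nat.mul_mod, Nat.pow_mod (10 ^ 6)]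
  norm_num

/-- For every positive integer `n`, the number `10176 * 10^n - 1`
(appending `n` copies of the digit 9 to 10175) is composite. -/
theorem stmt_7 (n : ℕ) (hn : 0 < n) :
    1 < 10176 * 10 ^ n - 1 ∧ ¬ Nat.Prime (10176 * 10 ^ n - 1) := by
  have h_ten : 10 ≤ 10 ^ n := Nat.le_self_pow hn.ne' 10
  refine ⟨by omega, ?_⟩
  have h_mod := ten_pow_mod_37037 n
  have h_lt : n % 6 < 6 := Nat.mod_lt n (by norm_num)
  have h_dvd : ∃ p, 2 ≤ p ∧ p < 100 ∧ p ∣ 10176 * 10 ^ n - 1 := by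
    generalize 10 ^ n = x at *
    generalize n % 6 = r at *
    interval_cases r
    · exact ⟨11, by norm_num, by norm_num, by omega⟩
    · exact ⟨7, by norm_num, by norm_num, by omega⟩
    · exact ⟨11, by norm_num, by norm_num, by omega⟩
    · exact ⟨37, by norm_num, by norm_num, by omega⟩
    · exact ⟨11, by norm_num, by norm_num, by omega⟩
    · exact ⟨13, by norm_num, by norm_num, by omega⟩
  obtain ⟨p, h_two_le, h_small, h_dvd⟩ := h_dvd
  exact Nat.not_prime_of_dvd_of_lt h_dvd h_two_le (by omega)
end

section
/- For every nonnegative integer n, at least one of the primes 7, 11, 13, 37 divides 10176·10^n − 1; more precisely, writing n = 6m + i with 0 ≤ i ≤ 5, the number is divisible by 11, 7, 11, 37, 11, 13 according as i = 0, 1, 2, 3, 4, 5. -/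
/-- If `a ^ d` is congruent to `1` modulo `p`, then divisibility of `c * a ^ n - 1` by `p` can be
checked on the exponent `n % d`. -/
theorem dvd_mul_pow_sub_one_of_mod {p a c d n : ℕ} (hc : 0 < c) (ha : 0 < a)
    (hd : a ^ d ≡ 1 [MOD p]) (h : p ∣ c * a ^ (n % d) - 1) : p ∣ c * a ^ n - 1 := by
  have pos (k : ℕ) : 1 ≤ c * a ^ k := Nat.mul_pos hc (Nat.pow_pos ha)
  rw [← Nat.modEq_iff_dvd' (pos _)] at h ⊢
  have hn : a ^ n ≡ a ^ (n % d) [MOD p] := by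
    conv_lhs => rw [← Nat.mod_add_div n d, pow_add, pow_mul]
    simpa using (hd.pow (n / d)).mul_left (a ^ (n % d))
  exact h.trans (hn.mul_left c).symm

/-- For every nonnegative integer `n`, at least one of the primes 7, 11, 13, 37 divides
`10176 * 10^n - 1`; more precisely, according as `n % 6 = 0,1,2,3,4,5`, the number is
divisible by `11, 7, 11, 37, 11, 13`. -/
theorem stmt_8 (n : ℕ) :
    (7 ∣ 10176 * 10 ^ n - 1 ∨ 11 ∣ 10176 * 10 ^ n - 1 ∨
     13 ∣ 10176 * 10 ^ n - 1 ∨ 37 ∣ 10176 * 10 ^ n - 1) ∧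
    (n % 6 = 0 → 11 ∣ 10176 * 10 ^ n - 1) ∧
    (n % 6 = 1 → 7 ∣ 10176 * 10 ^ n - 1) ∧
    (n % 6 = 2 → 11 ∣ 10176 * 10 ^ n - 1) ∧
    (n % 6 = 3 → 37 ∣ 10176 * 10 ^ n - 1) ∧
    (n % 6 = 4 → 11 ∣ 10176 * 10 ^ n - 1) ∧
    (n % 6 = 5 → 13 ∣ 10176 * 10 ^ n - 1) := by
  have h0 (h : n % 6 = 0) : 11 ∣ 10176 * 10 ^ n - 1 :=
    dvd_mul_pow_sub_one_of_mod (d := 6) (by decide) (by decide) (by decide) (by rw [h]; decide)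
  have h1 (h : n % 6 = 1) : 7 ∣ 10176 * 10 ^ n - 1 :=
    dvd_mul_pow_sub_one_of_mod (d := 6) (by decide) (by decide) (by decide) (by rw [h]; decide)
  have h2 (h : n % 6 = 2) : 11 ∣ 10176 * 10 ^ n - 1 :=
    dvd_mul_pow_sub_one_of_mod (d := 6) (by decide) (by decide) (by decide) (by rw [h]; decide)
  have h3 (h : n % 6 = 3) : 37 ∣ 10176 * 10 ^ n - 1 :=
    dvd_mul_pow_sub_one_of_mod (d := 6) (by decide) (by decide) (by decide) (by rw [h]; decide)
  have h4 (h : n % 6 = 4) : 11 ∣ 10176 * 10 ^ n - 1 :=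
    dvd_mul_pow_sub_one_of_mod (d := 6) (by decide) (by decide) (by decide) (by rw [h]; decide)
  have h5 (h : n % 6 = 5) : 13 ∣ 10176 * 10 ^ n - 1 :=
    dvd_mul_pow_sub_one_of_mod (d := 6) (by decide) (by decide) (by decide) (by rw [h]; decide)
  refine ⟨?_, h0, h1, h2, h3, h4, h5⟩
  have hn : n % 6 = 0 ∨ n % 6 = 1 ∨ n % 6 = 2 ∨ n % 6 = 3 ∨ n % 6 = 4 ∨ n % 6 = 5 := by omega
  tauto
end

section
/- For every positive integer n, the number 4070·10^n + (10^n − 1)/3 (obtained by appending n copies of the digit 3 to 4070) is composite. -/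
/-- For every positive integer `n`, the number `4070 * 10^n + (10^n - 1) / 3`
(appending `n` copies of the digit 3 to 4070) is composite. -/
theorem stmt_9 (n : ℕ) (hn : 0 < n) :
    1 < 4070 * 10 ^ n + (10 ^ n - 1) / 3 ∧
    ¬ Nat.Prime (4070 * 10 ^ n + (10 ^ n - 1) / 3) := by
  have hpos : 0 < 10 ^ n := by positivity
  -- The covering primes 7, 11, 13, 37 all divide `10 ^ 6 - 1`.
  have hperiod : 10 ^ n % 999999 = 10 ^ (n % 6) % 999999 := by
    conv_lhs => rw [← Nat.div_add_mod n 6, pow_add, pow_mul, Nat.mul_mod, Nat.pow_mod]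
    norm_num
  have hr : n % 6 < 6 := Nat.mod_lt _ (by norm_num)
  generalize n % 6 = r at hperiod hr
  generalize 10 ^ n = x at hpos hperiod
  have composite_of_dvd {p : ℕ} (hp : 1 < p) (hp' : p < 4070)
      (hdvd : p ∣ 4070 * x + (x - 1) / 3) : ¬ Nat.Prime (4070 * x + (x - 1) / 3) :=
    Nat.not_prime_of_dvd_of_lt hdvd hp (by omega)
  refine ⟨by omega, ?_⟩
  interval_cases r <;> norm_num at hperiod
  · exact composite_of_dvd (p := 11) (by norm_num) (by norm_num) (by omega)
  · exact composite_of_dvd (p := 13) (by norm_num) (by norm_num) (by omega)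
  · exact composite_of_dvd (p := 11) (by norm_num) (by norm_num) (by omega)
  · exact composite_of_dvd (p := 37) (by norm_num) (by norm_num) (by omega)
  · exact composite_of_dvd (p := 11) (by norm_num) (by norm_num) (by omega)
  · exact composite_of_dvd (p := 7) (by norm_num) (by norm_num) (by omega)
end

section
/- For every base-ten digit d ∈ {0,1,2,3,4,5,6,7,8,9} and every positive integer n, the number 6930·10^n + d·(10^n − 1)/9 (obtained by appending n copies of the digit d to 6930) is composite. -/
/-- If `10 ^ c ≡ 1` modulo `p`, then `10 ^ n` modulo `p` depends only on `n % c`. -/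
theorem ten_pow_mod_eq_of_period {p c : ℕ} (h : 10 ^ c % p = 1 % p) (n : ℕ) :
    10 ^ n % p = 10 ^ (n % c) % p := by
  have key : 10 ^ n ≡ 1 ^ (n / c) * 10 ^ (n % c) [MOD p] := by
    conv_lhs => rw [← Nat.div_add_mod n c, pow_add, pow_mul]
    exact (Nat.ModEq.pow _ h).mul_right _
  simpa [Nat.ModEq] using key

/-- A number exceeding one of its divisors `p > 1` is composite. -/
theorem one_lt_and_not_prime_of_dvd {p N : ℕ} (hp : 1 < p) (hlt : p < N) (h : p ∣ N) :
    1 < N ∧ ¬ Nat.Prime N :=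
  ⟨hp.trans hlt, Nat.not_prime_of_dvd_of_lt h hp hlt⟩

/-- For every base-ten digit `d` and every positive integer `n`, the number
`6930 * 10^n + d * (10^n - 1) / 9` (appending `n` copies of digit `d` to 6930)
is composite. -/
theorem stmt_10 (d : ℕ) (hd : d ≤ 9) (n : ℕ) (hn : 0 < n) :
    1 < 6930 * 10 ^ n + d * (10 ^ n - 1) / 9 ∧
    ¬ Nat.Prime (6930 * 10 ^ n + d * (10 ^ n - 1) / 9) := by
  have hpos : 1 ≤ 10 ^ n := Nat.one_le_pow _ _ (by norm_num)
  have h9 : 10 ^ n % 9 = 1 := by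
    simpa [Nat.mod_one] using ten_pow_mod_eq_of_period (p := 9) (c := 1) (by norm_num) n
  have h27 := ten_pow_mod_eq_of_period (p := 27) (c := 3) (by norm_num) n
  have h11 := ten_pow_mod_eq_of_period (p := 11) (c := 2) (by norm_num) n
  have h37 := ten_pow_mod_eq_of_period (p := 37) (c := 3) (by norm_num) n
  have h13 := ten_pow_mod_eq_of_period (p := 13) (c := 6) (by norm_num) n
  generalize 10 ^ n = m at *
  obtain rfl | hd1 := eq_or_ne d 1
  · have hcases : n % 2 = 0 ∨ n % 3 = 0 ∨ n % 3 = 1 ∨ n % 6 = 5 := by omega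
    rcases hcases with h | h | h | h
    · rw [h] at h11
      exact one_lt_and_not_prime_of_dvd (p := 11) (by norm_num) (by omega) (by omega)
    · rw [h] at h27
      exact one_lt_and_not_prime_of_dvd (p := 3) (by norm_num) (by omega) (by omega)
    · rw [h] at h37
      exact one_lt_and_not_prime_of_dvd (p := 37) (by norm_num) (by omega) (by omega)
    · rw [h] at h13
      exact one_lt_and_not_prime_of_dvd (p := 13) (by norm_num) (by omega) (by omega)
  · have hcases : d % 2 = 0 ∨ d % 3 = 0 ∨ d = 5 ∨ d = 7 := by omega
    obtain ⟨k, hk⟩ : 9 ∣ m - 1 := by omega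
    have hrep : d * (m - 1) / 9 = d * k := by
      rw [hk, Nat.mul_left_comm, Nat.mul_div_cancel_left _ (by norm_num)]
    have hcommon (p : ℕ) (hp : 1 < p) (hlt : p < 6930) (hp_dvd : p ∣ 6930) (hpd : p ∣ d) :
        1 < 6930 * m + d * (m - 1) / 9 ∧ ¬ Nat.Prime (6930 * m + d * (m - 1) / 9) := by
      refine one_lt_and_not_prime_of_dvd hp (by omega) ?_
      rw [hrep]
      exact dvd_add (hp_dvd.mul_right m) (hpd.mul_right k)
    rcases hcases with h | h | h | h
    · exact hcommon 2 (by norm_num) (by norm_num) (by norm_num) (by omega)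
    · exact hcommon 3 (by norm_num) (by norm_num) (by norm_num) (by omega)
    · exact hcommon 5 (by norm_num) (by norm_num) (by norm_num) (by omega)
    · exact hcommon 7 (by norm_num) (by norm_num) (by norm_num) (by omega)
end

section
/- For every nonnegative integer n, the number 509203·2^n − 1 is composite. -/
/-- The primes `3, 5, 7, 13, 17, 241`, for each of which the order of `2` divides `24`, form a
covering set for the sequence `509203 * 2 ^ n - 1`. -/
lemma exists_mem_covering_modEq_one (n : ℕ) :
    ∃ p ∈ [3, 5, 7, 13, 17, 241], 509203 * 2 ^ n ≡ 1 [MOD p] := by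
  have base : ∀ r < 24, ∃ p ∈ [3, 5, 7, 13, 17, 241], 509203 * 2 ^ r % p = 1 % p := by
    decide
  have period : ∀ p ∈ [3, 5, 7, 13, 17, 241], 2 ^ 24 % p = 1 % p := by decide
  obtain ⟨p, hp, hr⟩ := base (n % 24) (Nat.mod_lt n (by norm_num))
  refine ⟨p, hp, ?_⟩
  have hpow : (2 ^ 24) ^ (n / 24) ≡ 1 [MOD p] := by
    simpa using Nat.ModEq.pow (n / 24) (period p hp)
  calc 509203 * 2 ^ n = 509203 * 2 ^ (n % 24) * (2 ^ 24) ^ (n / 24) := by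
        rw [← pow_mul, mul_assoc, ← pow_add, Nat.mod_add_div]
    _ ≡ 1 * 1 [MOD p] := Nat.ModEq.mul hr hpow

/-- For every nonnegative integer `n`, the number `509203 * 2^n - 1` is composite. -/
theorem stmt_12 (n : ℕ) :
    1 < 509203 * 2 ^ n - 1 ∧ ¬ Nat.Prime (509203 * 2 ^ n - 1) := by
  have hpos : 1 ≤ 2 ^ n := Nat.one_le_two_pow
  refine ⟨by omega, ?_⟩
  obtain ⟨p, hp, hmod⟩ := exists_mem_covering_modEq_one n
  have hdvd : p ∣ 509203 * 2 ^ n - 1 := (Nat.modEq_iff_dvd' (by omega)).mp hmod.symm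
  have hbounds : ∀ q ∈ [3, 5, 7, 13, 17, 241], 2 ≤ q ∧ q ≤ 241 := by decide
  obtain ⟨hp2, hp241⟩ := hbounds p hp
  exact Nat.not_prime_of_dvd_of_lt hdvd hp2 (by omega)
end

section
/- Let m ≥ 3 be an odd integer and let b = m². For every positive integer n, the base-b repunit with n+1 digits, (b^(n+1) − 1)/(b − 1), is composite; consequently 1 is the minimal seed for the digit 1 in base b. -/
/-- For odd `m ≥ 3`, a repunit in base `m ^ 2` with at least two digits is not prime. -/
theorem not_prime_geomSum_sq {m : ℕ} (hm : 3 ≤ m) (hodd : Odd m) {n : ℕ} (hn : 0 < n) :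
    ¬ Nat.Prime (∑ i ∈ Finset.range (n + 1), (m ^ 2) ^ i) := by
  intro hp
  set p := ∑ i ∈ Finset.range (n + 1), (m ^ 2) ^ i with hpdef
  have hle : m ^ 2 ≤ m ^ (n + 1) := Nat.pow_le_pow_right (by omega) (by omega)
  have hm2 : 9 ≤ m ^ 2 := by nlinarith
  obtain ⟨a, ha⟩ : ∃ a, m ^ (n + 1) = a + 1 := ⟨m ^ (n + 1) - 1, by omega⟩
  obtain ⟨c, hc⟩ : ∃ c, m ^ 2 = c + 1 := ⟨m ^ 2 - 1, by omega⟩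
  have hfac : p * c = a * (a + 2) := by
    have h := geom_sum_mul_add c (n + 1)
    rw [← hc, ← hpdef, ← pow_mul, mul_comm 2, pow_mul, ha] at h
    linarith
  rcases (Nat.Prime.dvd_mul hp).1 (hfac ▸ Dvd.intro c rfl) with h | h
  · have := Nat.le_of_dvd (by omega) h
    nlinarith
  · have h2 := Nat.le_of_dvd (by omega) h
    have hac : a = c := by nlinarith
    have hpeq : p = m ^ 2 + 1 := by
      subst hac
      have := Nat.eq_of_mul_eq_mul_left (by omega) ((mul_comm a p).trans hfac)
      omega
    have heven : Even p := hpeq ▸ (hodd.pow.add_one)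
    have := (hp.even_iff).1 heven
    omega

/-- A repunit in base `b ≥ 2` with at least two digits exceeds `1`. -/
theorem one_lt_geomSum {b : ℕ} (hb : 2 ≤ b) {n : ℕ} (hn : 0 < n) :
    1 < ∑ i ∈ Finset.range (n + 1), b ^ i := by
  rw [Finset.sum_range_succ]
  have h : 1 < b ^ n := Nat.one_lt_pow hn.ne' (by omega)
  omega

/-- Let `m ≥ 3` be odd and `b = m^2`. For every positive integer `n`, the base-`b`
repunit with `n + 1` digits, `(b^(n+1) - 1) / (b - 1)`, is composite; consequently `1`
is the minimal seed for the digit 1 in base `b`. -/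
theorem stmt_14 (m : ℕ) (hm : 3 ≤ m) (hodd : Odd m) :
    (∀ n : ℕ, 0 < n →
      1 < ((m ^ 2) ^ (n + 1) - 1) / (m ^ 2 - 1) ∧
      ¬ Nat.Prime (((m ^ 2) ^ (n + 1) - 1) / (m ^ 2 - 1))) ∧
    IsLeast {k : ℕ | 0 < k ∧ ∀ n : ℕ, 0 < n →
      1 < k * (m ^ 2) ^ n + ((m ^ 2) ^ n - 1) / (m ^ 2 - 1) ∧
      ¬ Nat.Prime (k * (m ^ 2) ^ n + ((m ^ 2) ^ n - 1) / (m ^ 2 - 1))} 1 := by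
  have hb : 2 ≤ m ^ 2 := by nlinarith
  have hcomp : ∀ n : ℕ, 0 < n → 1 < ∑ i ∈ Finset.range (n + 1), (m ^ 2) ^ i ∧
      ¬ Nat.Prime (∑ i ∈ Finset.range (n + 1), (m ^ 2) ^ i) := fun n hn =>
    ⟨one_lt_geomSum hb hn, not_prime_geomSum_sq hm hodd hn⟩
  refine ⟨fun n hn => ?_, ⟨one_pos, fun n hn => ?_⟩, fun k hk => hk.1⟩
  · rw [← Nat.geomSum_eq hb]
    exact hcomp n hn
  · rw [← Nat.geomSum_eq hb, one_mul, add_comm, ← Finset.sum_range_succ]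
    exact hcomp n hn
end

section
/- For every positive integer n, the number 5·4^n + (4^n − 1)/3 (obtained by appending n copies of the digit 1 to 5 in base 4) is composite, and for every integer k with 1 ≤ k < 5 there exists a positive integer n such that k·4^n + (4^n − 1)/3 is prime; consequently 5 is the minimal seed for the digit 1 in base 4. -/
/-- If `3 * N` factors as `a * b` with both factors exceeding `3`, then `N` is not prime. -/
lemma not_prime_of_three_mul_eq_mul {N a b : ℕ} (ha : 3 < a) (hb : 3 < b)
    (h : 3 * N = a * b) : ¬ N.Prime := by
  intro hp
  rcases hp.dvd_mul.mp (h ▸ Dvd.intro_left 3 rfl) with hd | hd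
  · have := Nat.le_of_dvd (by lia) hd
    nlinarith
  · have := Nat.le_of_dvd (by lia) hd
    nlinarith

/-- Appending `n` digits `1` to `5` in base `4` gives `(2^(n+2) - 1) * (2^(n+2) + 1) / 3`. -/
lemma three_mul_five_append_ones (n : ℕ) :
    3 * (5 * 4 ^ n + (4 ^ n - 1) / 3) = (4 * 2 ^ n - 1) * (4 * 2 ^ n + 1) := by
  have hdvd : 3 ∣ 4 ^ n - 1 := by simpa using Nat.sub_dvd_pow_sub_pow 4 1 n
  have hpos : 0 < 4 ^ n := by positivity
  have hsq : 4 ^ n = 2 ^ n * 2 ^ n := by norm_num [← mul_pow]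
  have hfac : (4 * 2 ^ n - 1) * (4 * 2 ^ n + 1) = 16 * 4 ^ n - 1 := by
    rw [mul_comm, ← Nat.sq_sub_sq, hsq]
    ring_nf
  lia

lemma five_append_ones_composite {n : ℕ} (hn : 0 < n) :
    1 < 5 * 4 ^ n + (4 ^ n - 1) / 3 ∧ ¬ Nat.Prime (5 * 4 ^ n + (4 ^ n - 1) / 3) := by
  have h4 : 0 < 4 ^ n := by positivity
  have h2 : 2 ≤ 2 ^ n := Nat.le_self_pow hn.ne' 2
  exact ⟨by lia, not_prime_of_three_mul_eq_mul (by lia) (by lia) (three_mul_five_append_ones n)⟩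

lemma exists_append_ones_prime {k : ℕ} (hk : 1 ≤ k) (hk5 : k < 5) :
    ∃ n : ℕ, 0 < n ∧ Nat.Prime (k * 4 ^ n + (4 ^ n - 1) / 3) := by
  interval_cases k
  · exact ⟨1, by norm_num⟩
  · exact ⟨2, by norm_num⟩
  · exact ⟨1, by norm_num⟩
  · exact ⟨1, by norm_num⟩

/-- For every positive integer `n`, the number `5 * 4^n + (4^n - 1) / 3` (appending `n`
copies of the digit 1 to 5 in base 4) is composite, and for every `k` with `1 ≤ k < 5`
there is a positive `n` with `k * 4^n + (4^n - 1) / 3` prime; consequently `5` is the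
minimal seed for the digit 1 in base 4. -/
theorem stmt_15 :
    (∀ n : ℕ, 0 < n →
      1 < 5 * 4 ^ n + (4 ^ n - 1) / 3 ∧
      ¬ Nat.Prime (5 * 4 ^ n + (4 ^ n - 1) / 3)) ∧
    (∀ k : ℕ, 1 ≤ k → k < 5 →
      ∃ n : ℕ, 0 < n ∧ Nat.Prime (k * 4 ^ n + (4 ^ n - 1) / 3)) ∧
    IsLeast {k : ℕ | 0 < k ∧ ∀ n : ℕ, 0 < n →
      1 < k * 4 ^ n + (4 ^ n - 1) / 3 ∧
      ¬ Nat.Prime (k * 4 ^ n + (4 ^ n - 1) / 3)} 5 := by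
  refine ⟨fun _ => five_append_ones_composite, fun _ => exists_append_ones_prime,
    ⟨by norm_num, fun _ => five_append_ones_composite⟩, ?_⟩
  rintro k ⟨hk, hcomp⟩
  by_contra! hk5
  obtain ⟨n, hn, hp⟩ := exists_append_ones_prime hk hk5
  exact (hcomp n hn).2 hp
end
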